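/- Let p ≥ 2, θ < 1/p, and let f : ℝ → ℝ be smooth with compactly supported derivative. Then ∫_{{x : f(x) ≠ 0}} (|f'(x)|/|f(x)|^θ)^p dx ≤ ((p-1)/|1 − θp|)^{p/2} ∫_{{x : f(x) ≠ 0}} (√|f(x) f''(x)| / |f(x)|^θ)^p dx. -/

import Mathlib

open MeasureTheory

lemma hasDerivAt_abs_rpow_sub_two_mul_self {p : ℝ} (hp : 2 ≤ p) (y : ℝ) :
    HasDerivAt (fun y : ℝ => |y| ^ (p - 2) * y) ((p - 1) * |y| ^ (p - 2)) y := by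
  rcases eq_or_ne y 0 with rfl | hy
  · rw [hasDerivAt_iff_tendsto_slope]
    have hc : Continuous (fun y : ℝ => |y| ^ (p - 2)) :=
      continuous_abs.rpow_const fun _ => Or.inr (by linarith)
    have h0 : (p - 1) * |(0 : ℝ)| ^ (p - 2) = |(0 : ℝ)| ^ (p - 2) := by
      rcases eq_or_lt_of_le hp with h | h
      · subst h; norm_num
      · rw [abs_zero, Real.zero_rpow (by linarith), mul_zero]
    rw [h0]
    refine ((hc.tendsto 0).mono_left nhdsWithin_le_nhds).congr' ?_
    filter_upwards [self_mem_nhdsWithin] with z hz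
    have hz' : z ≠ 0 := hz
    simp [slope_def_field, hz']
  · have hpos : 0 < |y| := abs_pos.2 hy
    have h1 : HasDerivAt (fun y : ℝ => |y| ^ (p - 2))
        (SignType.sign y * (p - 2) * |y| ^ (p - 2 - 1)) y :=
      (hasDerivAt_abs hy).rpow_const (Or.inl hpos.ne')
    have h2 : (SignType.sign y : ℝ) * y = |y| := sign_mul_self y
    have h3 : |y| ^ (p - 2) = |y| ^ (p - 2 - 1) * |y| := by
      rw [← Real.rpow_add_one hpos.ne']; ring_nf
    refine (h1.mul (hasDerivAt_id y)).congr_deriv ?_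
    calc SignType.sign y * (p - 2) * |y| ^ (p - 2 - 1) * y + |y| ^ (p - 2) * 1
        = (p - 2) * |y| ^ (p - 2 - 1) * (SignType.sign y * y) + |y| ^ (p - 2) := by ring
      _ = (p - 1) * |y| ^ (p - 2) := by rw [h2, h3]; ring

/-- A primitive vanishing at zero of a function dominated by `|s| ^ (-q)`. -/
lemma abs_intervalIntegral_le_rpow {q : ℝ} (hq : q < 1) {ψ : ℝ → ℝ} (hψ : Continuous ψ)
    (h0 : ∀ s, 0 ≤ ψ s) (hle : ∀ s, ψ s ≤ |s| ^ (-q)) (t : ℝ) :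
    |∫ s in (0 : ℝ)..t, ψ s| ≤ |t| ^ (1 - q) / (1 - q) := by
  have key : ∀ χ : ℝ → ℝ, Continuous χ → (∀ s, 0 ≤ χ s) → (∀ s, χ s ≤ |s| ^ (-q)) →
      ∀ r, 0 ≤ r → |∫ s in (0 : ℝ)..r, χ s| ≤ r ^ (1 - q) / (1 - q) := by
    intro χ hχ h0 hle r hr
    rw [abs_of_nonneg (intervalIntegral.integral_nonneg hr fun s _ => h0 s)]
    calc ∫ s in (0 : ℝ)..r, χ s ≤ ∫ s in (0 : ℝ)..r, s ^ (-q) := by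
          refine intervalIntegral.integral_mono_on hr (hχ.intervalIntegrable _ _)
            (intervalIntegral.intervalIntegrable_rpow' (by linarith)) fun s hs => ?_
          simpa [abs_of_nonneg hs.1] using hle s
      _ = r ^ (1 - q) / (1 - q) := by
          rw [integral_rpow (Or.inl (by linarith)), neg_add_eq_sub,
            Real.zero_rpow (by linarith), sub_zero]
  rcases le_total 0 t with ht | ht
  · simpa [abs_of_nonneg ht] using key ψ hψ h0 hle t ht
  · have := key (fun s => ψ (-s)) (hψ.comp continuous_neg) (fun s => h0 _)
      (fun s => by simpa using hle (-s)) (-t) (by linarith)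
    rw [intervalIntegral.integral_comp_neg, neg_neg, neg_zero, intervalIntegral.integral_symm,
      abs_neg] at this
    rwa [abs_of_nonpos ht]

/-- Integration by parts against a continuous weight dominated by `|s| ^ (-q)`. -/
lemma integral_abs_deriv_rpow_mul_le {p q : ℝ} (hp : 2 ≤ p) (hq : q < 1) {f : ℝ → ℝ}
    (hf : ContDiff ℝ (⊤ : ℕ∞) f) (hsupp : HasCompactSupport (deriv f)) {ψ : ℝ → ℝ}
    (hψ : Continuous ψ) (h0 : ∀ s, 0 ≤ ψ s) (hle : ∀ s, ψ s ≤ |s| ^ (-q)) :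
    ∫ x, |deriv f x| ^ p * ψ (f x) ≤
      (p - 1) / (1 - q) *
        ∫ x, |deriv f x| ^ (p - 2) * |deriv (deriv f) x| * |f x| ^ (1 - q) := by
  have hf' : ContDiff ℝ (⊤ : ℕ∞) (deriv f) := (contDiff_infty_iff_deriv.1 hf).2
  have hf'' : Continuous (deriv (deriv f)) := (contDiff_infty_iff_deriv.1 hf').2.continuous
  have hd (x : ℝ) : HasDerivAt f (deriv f x) x :=
    (hf.differentiable (by simp) x).hasDerivAt
  have hd' (x : ℝ) : HasDerivAt (deriv f) (deriv (deriv f) x) x :=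
    (hf'.differentiable (by simp) x).hasDerivAt
  have hcp : Continuous (fun x => |deriv f x| ^ (p - 2)) :=
    hf'.continuous.abs.rpow_const fun _ => Or.inr (by linarith)
  set φ : ℝ → ℝ := fun t => ∫ s in (0 : ℝ)..t, ψ s with hφ
  have hφd (t : ℝ) : HasDerivAt φ (ψ t) t := hψ.integral_hasStrictDerivAt 0 t |>.hasDerivAt
  have hφc : Continuous φ := continuous_iff_continuousAt.2 fun t => (hφd t).continuousAt
  have hu (x : ℝ) : HasDerivAt (fun x => |deriv f x| ^ (p - 2) * deriv f x)
      ((p - 1) * |deriv f x| ^ (p - 2) * deriv (deriv f) x) x :=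
    (hasDerivAt_abs_rpow_sub_two_mul_self hp (deriv f x)).comp x (hd' x)
  have hv (x : ℝ) : HasDerivAt (fun x => φ (f x)) (ψ (f x) * deriv f x) x :=
    (hφd (f x)).comp x (hd x)
  have hsu : HasCompactSupport (fun x => |deriv f x| ^ (p - 2) * deriv f x) := hsupp.mul_left
  have hcu : Continuous (fun x => |deriv f x| ^ (p - 2) * deriv f x) := hcp.mul hf'.continuous
  have hsu' : HasCompactSupport
      (fun x => (p - 1) * |deriv f x| ^ (p - 2) * deriv (deriv f) x) := hsupp.deriv.mul_left
  have hcu' : Continuous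
      (fun x => (p - 1) * |deriv f x| ^ (p - 2) * deriv (deriv f) x) := by fun_prop
  have hcv : Continuous (fun x => φ (f x)) := hφc.comp hf.continuous
  have hcv' : Continuous (fun x => ψ (f x) * deriv f x) :=
    (hψ.comp hf.continuous).mul hf'.continuous
  have hi' := (hcu'.mul hcv).integrable_of_hasCompactSupport (μ := volume) hsu'.mul_right
  have parts := integral_mul_deriv_eq_deriv_mul_of_integrable
    (fun x _ => hu x) (fun x _ => hv x)
    ((hcu.mul hcv').integrable_of_hasCompactSupport hsu.mul_right) hi'
    ((hcu.mul hcv).integrable_of_hasCompactSupport hsu.mul_right)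
  have hpow (y : ℝ) : |y| ^ p = |y| ^ (p - 2) * y * y := by
    rw [mul_assoc, ← abs_mul_abs_self, ← sq, ← Real.rpow_natCast,
      ← Real.rpow_add_of_nonneg (abs_nonneg y) (by linarith) (by norm_num)]
    norm_num
  calc ∫ x, |deriv f x| ^ p * ψ (f x)
      = ∫ x, |deriv f x| ^ (p - 2) * deriv f x * (ψ (f x) * deriv f x) := by
        congr 1; ext x; rw [hpow]; ring
    _ = ∫ x, -((p - 1) * |deriv f x| ^ (p - 2) * deriv (deriv f) x * φ (f x)) := by
        rw [integral_neg]; exact parts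
    _ ≤ ∫ x, (p - 1) / (1 - q) *
          (|deriv f x| ^ (p - 2) * |deriv (deriv f) x| * |f x| ^ (1 - q)) := by
        refine integral_mono hi'.neg (Integrable.const_mul ?_ _) fun x => ?_
        · refine Continuous.integrable_of_hasCompactSupport
            ((hcp.mul hf''.abs).mul (hf.continuous.abs.rpow_const
              fun _ => Or.inr (by linarith))) ?_
          exact (HasCompactSupport.mul_left (hsupp.deriv.comp_left abs_zero)).mul_right
        · have hb := abs_intervalIntegral_le_rpow hq hψ h0 hle (f x)
          have hc : 0 ≤ (p - 1) * |deriv f x| ^ (p - 2) * |deriv (deriv f) x| :=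
            mul_nonneg (mul_nonneg (by linarith) (by positivity)) (abs_nonneg _)
          calc -((p - 1) * |deriv f x| ^ (p - 2) * deriv (deriv f) x * φ (f x))
              ≤ |(p - 1) * |deriv f x| ^ (p - 2) * deriv (deriv f) x * φ (f x)| := neg_le_abs _
            _ = (p - 1) * |deriv f x| ^ (p - 2) * |deriv (deriv f) x| * |φ (f x)| := by
                rw [abs_mul, abs_mul, abs_mul, abs_of_nonneg (by linarith : 0 ≤ p - 1),
                  abs_of_nonneg (by positivity : 0 ≤ |deriv f x| ^ (p - 2))]
            _ ≤ (p - 1) * |deriv f x| ^ (p - 2) * |deriv (deriv f) x| *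
                  (|f x| ^ (1 - q) / (1 - q)) := mul_le_mul_of_nonneg_left hb hc
            _ = _ := by ring
    _ = _ := integral_const_mul _ _

/-- Weighted Young inequality with exponents `p / (p - 2)` and `p / 2`. -/
lemma mul_rpow_sub_two_mul_le {p C a b : ℝ} (hp : 2 ≤ p) (hC : 0 ≤ C) (ha : 0 ≤ a)
    (hb : 0 ≤ b) :
    C * (a ^ (p - 2) * b) ≤
      (1 - 2 / p) * a ^ p + 2 / p * (C ^ (p / 2) * b ^ (p / 2)) := by
  have hp0 : 0 < p := by linarith
  have h := Real.geom_mean_le_arith_mean2_weighted (w₁ := 1 - 2 / p) (w₂ := 2 / p)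
    (p₁ := a ^ p) (p₂ := (C * b) ^ (p / 2))
    (by rw [sub_nonneg, div_le_one hp0]; exact hp) (by positivity) (by positivity)
    (by positivity) (by ring)
  rw [← Real.rpow_mul ha, ← Real.rpow_mul (by positivity),
    show p * (1 - 2 / p) = p - 2 by field_simp, show p / 2 * (2 / p) = 1 by field_simp,
    Real.rpow_one, Real.mul_rpow hC hb] at h
  linarith

lemma setIntegral_abs_deriv_rpow_le {p q : ℝ} (hp : 2 ≤ p) (hq : q < 1) {f : ℝ → ℝ}
    (hf : ContDiff ℝ (⊤ : ℕ∞) f) (hsupp : HasCompactSupport (deriv f))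
    (hI : IntegrableOn (fun x => |deriv f x| ^ p * |f x| ^ (-q)) {x | f x ≠ 0}) :
    ∫ x in {x | f x ≠ 0}, |deriv f x| ^ p * |f x| ^ (-q) ≤
      (p - 1) / (1 - q) *
        ∫ x in {x | f x ≠ 0},
          |deriv f x| ^ (p - 2) * |deriv (deriv f) x| * |f x| ^ (1 - q) := by
  have hf' : Continuous (deriv f) := (contDiff_infty_iff_deriv.1 hf).2.continuous
  have hS : MeasurableSet {x | f x ≠ 0} :=
    (isOpen_ne_fun hf.continuous continuous_const).measurableSet
  have hcp : Continuous (fun x => |deriv f x| ^ p) :=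
    hf'.abs.rpow_const fun _ => Or.inr (by linarith)
  rw [setIntegral_eq_integral_of_forall_compl_eq_zero
    (f := fun x => |deriv f x| ^ (p - 2) * |deriv (deriv f) x| * |f x| ^ (1 - q))
    fun x hx => by
      have : f x = 0 := not_not.1 hx
      rw [this, abs_zero, Real.zero_rpow (by linarith), mul_zero]]
  set ε : ℕ → ℝ := fun n => 1 / ((n : ℝ) + 1) with hε
  have hεpos (n : ℕ) : 0 < ε n := Nat.one_div_pos_of_nat
  set ψ : ℕ → ℝ → ℝ := fun n s => |s| ^ (1 - q) / max |s| (ε n) with hψdef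
  have hψ (n : ℕ) : Continuous (ψ n) :=
    (continuous_abs.rpow_const fun _ => Or.inr (by linarith)).div
      (continuous_abs.max continuous_const) fun s =>
        ((hεpos n).trans_le (le_max_right |s| (ε n))).ne'
  have h0 (n : ℕ) (s : ℝ) : 0 ≤ ψ n s := by
    have := (hεpos n).trans_le (le_max_right |s| (ε n))
    positivity
  have heq {s : ℝ} (hs : s ≠ 0) : |s| ^ (1 - q) / |s| = |s| ^ (-q) := by
    rw [← Real.rpow_sub_one (abs_pos.2 hs).ne']; ring_nf
  have hle (n : ℕ) (s : ℝ) : ψ n s ≤ |s| ^ (-q) := by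
    rcases eq_or_ne s 0 with rfl | hs
    · simp only [hψdef, abs_zero]
      rw [Real.zero_rpow (by linarith), zero_div]
      exact Real.rpow_nonneg le_rfl _
    · rw [← heq hs]
      have := abs_pos.2 hs
      exact div_le_div_of_nonneg_left (by positivity) this (le_max_left _ _)
  have hlim : Filter.Tendsto
      (fun n => ∫ x in {x | f x ≠ 0}, |deriv f x| ^ p * ψ n (f x)) Filter.atTop
      (nhds (∫ x in {x | f x ≠ 0}, |deriv f x| ^ p * |f x| ^ (-q))) := by
    refine tendsto_integral_of_dominated_convergence _
      (fun n => (hcp.mul ((hψ n).comp hf.continuous)).aestronglyMeasurable) hI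
      (fun n => ae_of_all _ fun x => ?_) ?_
    · rw [Real.norm_of_nonneg (mul_nonneg (by positivity) (h0 n _))]
      exact mul_le_mul_of_nonneg_left (hle n _) (by positivity)
    · filter_upwards [ae_restrict_mem hS] with x hx
      refine tendsto_const_nhds.congr' ?_
      have hx' : 0 < |f x| := abs_pos.2 hx
      filter_upwards [tendsto_one_div_add_atTop_nhds_zero_nat.eventually (gt_mem_nhds hx')]
        with n hn
      simp only [hψdef]
      rw [max_eq_left hn.le, heq hx]
  refine le_of_tendsto' hlim fun n => le_trans ?_
    (integral_abs_deriv_rpow_mul_le hp hq hf hsupp (hψ n) (h0 n) (hle n))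
  refine setIntegral_le_integral ?_ (ae_of_all _ fun x => mul_nonneg (by positivity) (h0 n _))
  refine (hcp.mul ((hψ n).comp hf.continuous)).integrable_of_hasCompactSupport
    (HasCompactSupport.mul_right ?_)
  exact hsupp.comp_left (g := fun y : ℝ => |y| ^ p)
    (by rw [abs_zero, Real.zero_rpow (by linarith)])

theorem power_weight_inequality_small_theta
    (p θ : ℝ) (hp : 2 ≤ p) (hθ : θ < 1 / p)
    (f : ℝ → ℝ) (hf : ContDiff ℝ (⊤ : ℕ∞) f) (hsupp : HasCompactSupport (deriv f)) :
    ∫ x in {x : ℝ | f x ≠ 0}, (|deriv f x| / |f x| ^ θ) ^ p ≤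
      ((p - 1) / |1 - θ * p|) ^ (p / 2) *
        ∫ x in {x : ℝ | f x ≠ 0},
          (Real.sqrt |f x * deriv (deriv f) x| / |f x| ^ θ) ^ p := by
  have hp0 : 0 < p := by linarith
  have hq : θ * p < 1 := (lt_div_iff₀ hp0).1 hθ
  rw [abs_of_pos (by linarith : 0 < 1 - θ * p)]
  set q := θ * p with hqdef
  set C := (p - 1) / (1 - q) with hC
  have hC0 : 0 ≤ C := div_nonneg (by linarith) (by linarith)
  have hf' : ContDiff ℝ (⊤ : ℕ∞) (deriv f) := (contDiff_infty_iff_deriv.1 hf).2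
  have hf'' : Continuous (deriv (deriv f)) := (contDiff_infty_iff_deriv.1 hf').2.continuous
  have hS : MeasurableSet {x | f x ≠ 0} :=
    (isOpen_ne_fun hf.continuous continuous_const).measurableSet
  have hweight (a s : ℝ) (ha : 0 ≤ a) : (a / |s| ^ θ) ^ p = a ^ p * |s| ^ (-q) := by
    rw [Real.div_rpow ha (by positivity), ← Real.rpow_mul (abs_nonneg s),
      Real.rpow_neg (abs_nonneg s), div_eq_mul_inv]
  have hsqrt (x : ℝ) (hx : x ∈ {x | f x ≠ 0}) :
      (Real.sqrt |f x * deriv (deriv f) x| / |f x| ^ θ) ^ p =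
        |deriv (deriv f) x| ^ (p / 2) * |f x| ^ (p / 2 - q) := by
    have hx' : 0 < |f x| := abs_pos.2 hx
    rw [hweight _ _ (Real.sqrt_nonneg _), Real.sqrt_eq_rpow, ← Real.rpow_mul (abs_nonneg _),
      abs_mul, Real.mul_rpow (abs_nonneg _) (abs_nonneg _), sub_eq_add_neg,
      Real.rpow_add hx', one_div_mul_eq_div]
    ring
  simp_rw [hweight _ _ (abs_nonneg _)]
  rw [setIntegral_congr_fun hS hsqrt]
  by_cases hI : IntegrableOn (fun x => |deriv f x| ^ p * |f x| ^ (-q)) {x | f x ≠ 0}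
  swap
  · rw [integral_undef hI]
    exact mul_nonneg (by positivity) (integral_nonneg fun x => by positivity)
  have hJ : IntegrableOn
      (fun x => |deriv (deriv f) x| ^ (p / 2) * |f x| ^ (p / 2 - q)) {x | f x ≠ 0} := by
    refine (Continuous.integrable_of_hasCompactSupport
      ((hf''.abs.rpow_const fun _ => Or.inr (by positivity)).mul
        (hf.continuous.abs.rpow_const fun _ => Or.inr (by linarith)))
      (HasCompactSupport.mul_right ?_)).integrableOn
    exact hsupp.deriv.comp_left (g := fun y : ℝ => |y| ^ (p / 2))
      (by rw [abs_zero, Real.zero_rpow (by positivity)])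
  have hK : IntegrableOn
      (fun x => |deriv f x| ^ (p - 2) * |deriv (deriv f) x| * |f x| ^ (1 - q))
      {x | f x ≠ 0} := by
    refine (Continuous.integrable_of_hasCompactSupport
      (((hf'.continuous.abs.rpow_const fun _ => Or.inr (by linarith)).mul hf''.abs).mul
        (hf.continuous.abs.rpow_const fun _ => Or.inr (by linarith))) ?_).integrableOn
    exact (HasCompactSupport.mul_left (hsupp.deriv.comp_left abs_zero)).mul_right
  have hyoung := setIntegral_mono_on (hK.const_mul C)
    ((hI.const_mul (1 - 2 / p)).add (hJ.const_mul (2 / p * C ^ (p / 2)))) hS fun x hx => by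
      have hx' : 0 < |f x| := abs_pos.2 hx
      have h := mul_le_mul_of_nonneg_right
        (mul_rpow_sub_two_mul_le hp hC0 (abs_nonneg (deriv f x))
          (mul_nonneg (abs_nonneg (f x)) (abs_nonneg (deriv (deriv f) x))))
        (Real.rpow_nonneg (abs_nonneg (f x)) (-q))
      rw [Real.mul_rpow (abs_nonneg _) (abs_nonneg _)] at h
      simp only [Pi.add_apply]
      rw [sub_eq_add_neg 1 q, sub_eq_add_neg (p / 2) q, Real.rpow_add hx', Real.rpow_add hx',
        Real.rpow_one]
      linarith
  simp only [Pi.add_apply] at hyoung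
  rw [integral_add (hI.const_mul _) (hJ.const_mul _), integral_const_mul, integral_const_mul,
    integral_const_mul] at hyoung
  have hmain := (setIntegral_abs_deriv_rpow_le hp hq hf hsupp hI).trans hyoung
  have h2p : 0 < 2 / p := by positivity
  refine le_of_mul_le_mul_left ?_ h2p
  linarith
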